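/- arXiv:1808.01401 — 6 statements merged into one kernel-verified Lean document; each statement's English description precedes it below -/
import Mathlib

section
/- For every real number t > 0, setting V = π·t·(3 + t²)/6, the expression ((3V + √(9V² + π²))^{2/3} − π^{2/3}) / (π^{1/3}·(3V + √(9V² + π²))^{1/3}) equals t. That is, the paper's explicit formula for the maximum vertical height z_M of the spherical cap of enclosed volume V recovers the cap height t. -/
open Real

/-- The quantity under the cube roots is `π * s ^ 3`, where `s` is the positive root of
`s ^ 2 = t * s + 1`. -/
lemma exists_cube_eq_add_sqrt (t : ℝ) (ht : 0 < t) (V : ℝ) (hV : V = π * t * (3 + t ^ 2) / 6) :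
    ∃ s : ℝ, 0 < s ∧ s ^ 2 = t * s + 1 ∧
      3 * V + Real.sqrt (9 * V ^ 2 + π ^ 2) = π * s ^ 3 := by
  have hr : Real.sqrt (t ^ 2 + 4) ^ 2 = t ^ 2 + 4 := Real.sq_sqrt (by positivity)
  have hr0 : 0 ≤ Real.sqrt (t ^ 2 + 4) := Real.sqrt_nonneg _
  set r := Real.sqrt (t ^ 2 + 4)
  have hsqrt : Real.sqrt (9 * V ^ 2 + π ^ 2) = π * (t ^ 2 + 1) * r / 2 := by
    rw [Real.sqrt_eq_iff_mul_self_eq (by positivity) (by have := Real.pi_pos; positivity), hV]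
    linear_combination -π ^ 2 * (t ^ 2 + 1) ^ 2 / 4 * hr
  refine ⟨(t + r) / 2, by positivity, by linear_combination hr / 4, ?_⟩
  rw [hsqrt, hV]
  linear_combination -π * (3 * t + r) / 8 * hr

theorem spherical_cap_height_formula (t : ℝ) (ht : 0 < t)
    (V : ℝ) (hV : V = π * t * (3 + t ^ 2) / 6) :
    ((3 * V + Real.sqrt (9 * V ^ 2 + π ^ 2)) ^ ((2 : ℝ) / 3) - π ^ ((2 : ℝ) / 3)) /
      (π ^ ((1 : ℝ) / 3) * (3 * V + Real.sqrt (9 * V ^ 2 + π ^ 2)) ^ ((1 : ℝ) / 3)) = t := by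
  obtain ⟨s, hs, hst, hA⟩ := exists_cube_eq_add_sqrt t ht V hV
  have hpi := Real.pi_pos
  have hcbrt : (π * s ^ 3) ^ ((1 : ℝ) / 3) = π ^ ((1 : ℝ) / 3) * s := by
    rw [Real.mul_rpow hpi.le (by positivity), ← Real.rpow_natCast, ← Real.rpow_mul hs.le]
    norm_num
  have hsq (x : ℝ) (hx : 0 < x) : x ^ ((2 : ℝ) / 3) = (x ^ ((1 : ℝ) / 3)) ^ 2 := by
    rw [← Real.rpow_natCast, ← Real.rpow_mul hx.le]
    norm_num
  have hc : 0 < π ^ ((1 : ℝ) / 3) := by positivity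
  rw [hA, hsq _ (by positivity), hsq π hpi, hcbrt, div_eq_iff (by positivity)]
  linear_combination (π ^ ((1 : ℝ) / 3)) ^ 2 * hst
end

section
/- For every real number t > 0, setting V = π·t·(3 + t²)/6, the expression −2·π^{1/3}·(3V + √(π² + 9V²) − π^{2/3}·(√(π² + 9V²) − 3V)^{1/3}) / (√(π² + 9V²)·(3V + √(π² + 9V²))^{1/3}) equals −4t/(1 + t²). That is, the paper's explicit formula for the pressure λ = 2H of the spherical cap of enclosed volume V equals −2/r, where r = (1 + t²)/(2t) is the radius of the sphere of maximum height t passing through the unit circle. -/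
open Real

lemma rpow_one_third_mul_cube {x y : ℝ} (hx : 0 ≤ x) (hy : 0 ≤ y) :
    (x * y ^ 3) ^ ((1 : ℝ) / 3) = x ^ ((1 : ℝ) / 3) * y := by
  rw [mul_rpow hx (pow_nonneg hy 3), ← rpow_natCast y 3, ← rpow_mul hy]
  norm_num

theorem spherical_cap_pressure_formula (t : ℝ) (ht : 0 < t)
    (V : ℝ) (hV : V = π * t * (3 + t ^ 2) / 6) :
    -2 * π ^ ((1 : ℝ) / 3) *
        (3 * V + Real.sqrt (π ^ 2 + 9 * V ^ 2) -
          π ^ ((2 : ℝ) / 3) * (Real.sqrt (π ^ 2 + 9 * V ^ 2) - 3 * V) ^ ((1 : ℝ) / 3)) /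
      (Real.sqrt (π ^ 2 + 9 * V ^ 2) *
        (3 * V + Real.sqrt (π ^ 2 + 9 * V ^ 2)) ^ ((1 : ℝ) / 3)) =
      -4 * t / (1 + t ^ 2) := by
  obtain ⟨s, hs, hs2⟩ : ∃ s : ℝ, 0 < s ∧ s ^ 2 = t ^ 2 + 4 :=
    ⟨√(t ^ 2 + 4), by positivity, sq_sqrt (by positivity)⟩
  have hts : t < s := by nlinarith
  have hπ := pi_pos
  have hroot : √(π ^ 2 + 9 * V ^ 2) = π * (t ^ 2 + 1) * s / 2 := by
    rw [sqrt_eq_iff_mul_self_eq (by positivity) (by positivity), hV]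
    linear_combination (-π ^ 2 * (t ^ 2 + 1) ^ 2 / 4) * hs2
  have hadd : 3 * V + π * (t ^ 2 + 1) * s / 2 = π * ((s + t) / 2) ^ 3 := by
    rw [hV]
    linear_combination (-π * (s + 3 * t) / 8) * hs2
  have hsub : π * (t ^ 2 + 1) * s / 2 - 3 * V = π * ((s - t) / 2) ^ 3 := by
    rw [hV]
    linear_combination (-π * (s - 3 * t) / 8) * hs2
  have hmul : π ^ ((2 : ℝ) / 3) * π ^ ((1 : ℝ) / 3) = π := by
    rw [← rpow_add hπ]
    norm_num
  have hp : 0 < π ^ ((1 : ℝ) / 3) := by positivity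
  rw [hroot, hadd, hsub, rpow_one_third_mul_cube hπ.le (by linarith),
    rpow_one_third_mul_cube hπ.le (by linarith), ← mul_assoc, hmul]
  have hnum : π * ((s + t) / 2) ^ 3 - π * ((s - t) / 2) = π * ((s + t) / 2) * (t * s) := by
    linear_combination (π * (s - t) / 8) * hs2
  rw [hnum]
  have hst : 0 < s + t := by linarith
  field_simp
  ring
end

section
/- The function z_M : (0, ∞) → ℝ defined by z_M(V) = ((3V + √(9V² + π²))^{2/3} − π^{2/3}) / (π^{1/3}·(3V + √(9V² + π²))^{1/3}) is strictly increasing in V. -/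
open Real

theorem strictMonoOn_sq_sub_sq_div_mul {b : ℝ} (hb : 0 < b) :
    StrictMonoOn (fun u : ℝ => (u ^ 2 - b ^ 2) / (b * u)) (Set.Ioi 0) := by
  intro u hu v hv huv
  have hu' : 0 < u := hu
  have hv' : 0 < v := hv
  change (u ^ 2 - b ^ 2) / (b * u) < (v ^ 2 - b ^ 2) / (b * v)
  rw [div_lt_div_iff₀ (by positivity) (by positivity), ← sub_pos]
  have key : (v ^ 2 - b ^ 2) * (b * u) - (u ^ 2 - b ^ 2) * (b * v)
      = b * (v - u) * (u * v + b ^ 2) := by ring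
  have hvu : 0 < v - u := sub_pos.2 huv
  rw [key]
  positivity

theorem rpow_two_thirds_eq_sq {x : ℝ} (hx : 0 ≤ x) :
    x ^ ((2 : ℝ) / 3) = (x ^ ((1 : ℝ) / 3)) ^ 2 := by
  rw [← rpow_mul_natCast hx]
  norm_num

theorem spherical_cap_height_strict_mono :
    StrictMonoOn (fun V : ℝ =>
        ((3 * V + Real.sqrt (9 * V ^ 2 + π ^ 2)) ^ ((2 : ℝ) / 3) - π ^ ((2 : ℝ) / 3)) /
          (π ^ ((1 : ℝ) / 3) * (3 * V + Real.sqrt (9 * V ^ 2 + π ^ 2)) ^ ((1 : ℝ) / 3)))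
      (Set.Ioi 0) := by
  intro V hV W hW hVW
  have hV' : 0 < V := hV
  have hW' : 0 < W := hW
  have hsqrt : √(9 * V ^ 2 + π ^ 2) ≤ √(9 * W ^ 2 + π ^ 2) := by gcongr
  have hlt : 3 * V + √(9 * V ^ 2 + π ^ 2) < 3 * W + √(9 * W ^ 2 + π ^ 2) := by linarith
  have hs : 0 < 3 * V + √(9 * V ^ 2 + π ^ 2) := by positivity
  have ht := hs.trans hlt
  simp only [rpow_two_thirds_eq_sq hs.le, rpow_two_thirds_eq_sq ht.le,
    rpow_two_thirds_eq_sq pi_pos.le]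
  exact strictMonoOn_sq_sub_sq_div_mul (rpow_pos_of_pos pi_pos _) (rpow_pos_of_pos hs _)
    (rpow_pos_of_pos ht _) (rpow_lt_rpow hs.le hlt (by norm_num))
end

section
/- Fix l > 0 and define V : (0, ∞) → ℝ by V(t) = 2(r(t)²·ζ(t) − l·z₀(t)), where r(t) = (l² + t²)/(2t), ζ(t) = arccos((l² − t²)/(l² + t²)), and z₀(t) = (l² − t²)/(2t). Then V is a strictly increasing bijection from (0, ∞) onto (0, ∞); in particular V(t) → 0 as t → 0⁺ and V(t) → ∞ as t → ∞, so the enclosed volume V can be used as a free parameter in place of the height t. -/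
open Real Filter

/-- The volume of the drop over the strip of half-width one, as a function of its height. -/
noncomputable def unitDropVolume (s : ℝ) : ℝ :=
  ((1 + s ^ 2) ^ 2 * arctan s - s + s ^ 3) / s ^ 2

theorem arctan_lt_self_of_pos {s : ℝ} (hs : 0 < s) : arctan s < s := by
  have h := lt_tan (arctan_pos.2 hs) (arctan_lt_pi_div_two s)
  rwa [tan_arctan] at h

theorem div_one_add_sq_lt_arctan {s : ℝ} (hs : 0 < s) : s / (1 + s ^ 2) < arctan s := by
  have h := sin_lt (x := 2 * arctan s) (by linarith [arctan_pos.2 hs])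
  have hsin : sin (2 * arctan s) = 2 * (s / (1 + s ^ 2)) := by
    rw [sin_two_mul, ← tan_mul_cos (cos_arctan_pos s).ne', tan_arctan]
    have := cos_sq_arctan s
    calc 2 * (s * cos (arctan s)) * cos (arctan s) = 2 * s * cos (arctan s) ^ 2 := by ring
      _ = _ := by rw [this]; ring
  linarith

theorem arccos_one_sub_sq_div_one_add_sq {s : ℝ} (hs : 0 ≤ s) :
    arccos ((1 - s ^ 2) / (1 + s ^ 2)) = 2 * arctan s := by
  have hcos : cos (2 * arctan s) = (1 - s ^ 2) / (1 + s ^ 2) := by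
    rw [cos_two_mul, cos_sq_arctan]
    field_simp
    ring
  rw [← hcos, arccos_cos (by linarith [arctan_nonneg.2 hs])
    (by linarith [arctan_lt_pi_div_two s])]

theorem hasDerivAt_unitDropVolume {s : ℝ} (hs : s ≠ 0) :
    HasDerivAt unitDropVolume
      (2 * (1 + s ^ 2) * ((s ^ 2 - 1) * arctan s + s) / s ^ 3) s := by
  have hsq : HasDerivAt (fun x : ℝ => x ^ 2) (2 * s) s := by
    simpa using hasDerivAt_pow 2 s
  have hcube : HasDerivAt (fun x : ℝ => x ^ 3) (3 * s ^ 2) s := by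
    simpa using hasDerivAt_pow 3 s
  have h := ((((hsq.const_add 1).pow 2).mul (hasDerivAt_arctan s)).sub
    (hasDerivAt_id s)).add hcube |>.div hsq (pow_ne_zero 2 hs)
  refine HasDerivAt.congr_deriv (f := unitDropVolume) h ?_
  simp only [Pi.add_apply, Pi.sub_apply, Pi.mul_apply, Pi.pow_apply, id, Nat.cast_ofNat]
  field_simp
  ring

theorem continuousOn_unitDropVolume : ContinuousOn unitDropVolume (Set.Ioi 0) :=
  fun _ hs => (hasDerivAt_unitDropVolume (ne_of_gt hs)).continuousAt.continuousWithinAt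

theorem strictMonoOn_unitDropVolume : StrictMonoOn unitDropVolume (Set.Ioi 0) := by
  refine strictMonoOn_of_deriv_pos (convex_Ioi 0) continuousOn_unitDropVolume fun s hs => ?_
  rw [interior_Ioi] at hs
  have hs : 0 < s := hs
  rw [(hasDerivAt_unitDropVolume hs.ne').deriv]
  have h₀ := arctan_pos.2 hs
  have h₁ := arctan_lt_self_of_pos hs
  have : 0 < (s ^ 2 - 1) * arctan s + s := by
    nlinarith [mul_pos (pow_pos hs 2) h₀]
  positivity

theorem two_mul_lt_unitDropVolume {s : ℝ} (hs : 0 < s) : 2 * s < unitDropVolume s := by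
  have h := div_one_add_sq_lt_arctan hs
  rw [div_lt_iff₀ (by positivity)] at h
  rw [unitDropVolume, lt_div_iff₀ (by positivity)]
  nlinarith [mul_lt_mul_of_pos_right h (show 0 < 1 + s ^ 2 by positivity)]

theorem unitDropVolume_lt {s : ℝ} (hs : 0 < s) : unitDropVolume s < 3 * s + s ^ 3 := by
  have h := arctan_lt_self_of_pos hs
  rw [unitDropVolume, div_lt_iff₀ (by positivity)]
  nlinarith [mul_lt_mul_of_pos_left h (show 0 < (1 + s ^ 2) ^ 2 by positivity)]

theorem tendsto_unitDropVolume_nhdsGT_zero :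
    Tendsto unitDropVolume (nhdsWithin 0 (Set.Ioi 0)) (nhds 0) := by
  have hlower : Tendsto (fun s : ℝ => 2 * s) (nhdsWithin 0 (Set.Ioi 0)) (nhds 0) :=
    ((by fun_prop : Continuous fun s : ℝ => 2 * s).tendsto' 0 0 (by simp)).mono_left
      nhdsWithin_le_nhds
  have hupper : Tendsto (fun s : ℝ => 3 * s + s ^ 3) (nhdsWithin 0 (Set.Ioi 0)) (nhds 0) :=
    ((by fun_prop : Continuous fun s : ℝ => 3 * s + s ^ 3).tendsto' 0 0 (by simp)).mono_left
      nhdsWithin_le_nhds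
  refine tendsto_of_tendsto_of_tendsto_of_le_of_le' hlower hupper ?_ ?_
  · filter_upwards [self_mem_nhdsWithin] with s hs using (two_mul_lt_unitDropVolume hs).le
  · filter_upwards [self_mem_nhdsWithin] with s hs using (unitDropVolume_lt hs).le

theorem tendsto_unitDropVolume_atTop : Tendsto unitDropVolume atTop atTop := by
  refine tendsto_atTop_mono' atTop ?_ (tendsto_id.const_mul_atTop (zero_lt_two' ℝ))
  filter_upwards [eventually_gt_atTop 0] with s hs using (two_mul_lt_unitDropVolume hs).le

theorem drop_volume_eq_sq_mul_unitDropVolume {l t : ℝ} (hl : 0 < l) (ht : 0 < t) :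
    2 * (((l ^ 2 + t ^ 2) / (2 * t)) ^ 2 *
          arccos ((l ^ 2 - t ^ 2) / (l ^ 2 + t ^ 2)) -
        l * ((l ^ 2 - t ^ 2) / (2 * t))) = l ^ 2 * unitDropVolume (t / l) := by
  have harg : (l ^ 2 - t ^ 2) / (l ^ 2 + t ^ 2) = (1 - (t / l) ^ 2) / (1 + (t / l) ^ 2) := by
    field_simp
  rw [harg, arccos_one_sub_sq_div_one_add_sq (by positivity), unitDropVolume]
  field_simp
  ring

theorem sessile_drop_volume_bijection (l : ℝ) (hl : 0 < l)
    (V : ℝ → ℝ)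
    (hV : ∀ t : ℝ, V t =
      2 * (((l ^ 2 + t ^ 2) / (2 * t)) ^ 2 *
          Real.arccos ((l ^ 2 - t ^ 2) / (l ^ 2 + t ^ 2)) -
        l * ((l ^ 2 - t ^ 2) / (2 * t)))) :
    StrictMonoOn V (Set.Ioi 0) ∧
    Set.BijOn V (Set.Ioi 0) (Set.Ioi 0) ∧
    Tendsto V (nhdsWithin 0 (Set.Ioi 0)) (nhds 0) ∧
    Tendsto V atTop atTop := by
  have hl2 : 0 < l ^ 2 := by positivity
  have hscale : Set.EqOn (fun t => l ^ 2 * unitDropVolume (t / l)) V (Set.Ioi 0) :=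
    fun t ht => ((hV t).trans (drop_volume_eq_sq_mul_unitDropVolume hl ht)).symm
  have hmaps : Set.MapsTo (fun t : ℝ => t / l) (Set.Ioi 0) (Set.Ioi 0) :=
    fun t ht => div_pos ht hl
  have hmono : StrictMonoOn V (Set.Ioi 0) := by
    refine StrictMonoOn.congr (fun a ha b hb hab => ?_) hscale
    exact mul_lt_mul_of_pos_left (strictMonoOn_unitDropVolume (hmaps ha) (hmaps hb)
      (div_lt_div_of_pos_right hab hl)) hl2
  have hcont : ContinuousOn V (Set.Ioi 0) :=
    (continuousOn_const.mul (continuousOn_unitDropVolume.comp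
      (continuous_id.div_const l).continuousOn hmaps)).congr hscale.symm
  have hzero : Tendsto V (nhdsWithin 0 (Set.Ioi 0)) (nhds 0) := by
    have hdiv : Tendsto (fun t : ℝ => t / l) (nhdsWithin 0 (Set.Ioi 0))
        (nhdsWithin 0 (Set.Ioi 0)) :=
      tendsto_nhdsWithin_of_tendsto_nhds_of_eventually_within _
        (((continuous_id.div_const l).tendsto' 0 0 (by simp)).mono_left nhdsWithin_le_nhds)
        (eventually_mem_nhdsWithin.mono hmaps)
    have h := (tendsto_unitDropVolume_nhdsGT_zero.comp hdiv).const_mul (l ^ 2)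
    rw [mul_zero] at h
    exact h.congr' (hscale.eventuallyEq_nhdsWithin)
  have htop : Tendsto V atTop atTop :=
    ((tendsto_unitDropVolume_atTop.comp (tendsto_id.atTop_div_const hl)).const_mul_atTop
      hl2).congr' (hscale.eventuallyEq_of_mem (Ioi_mem_atTop 0))
  refine ⟨hmono, ⟨fun t ht => ?_, hmono.injOn, ?_⟩, hzero, htop⟩
  · rw [← hscale ht]
    have hs : 0 < t / l := hmaps ht
    exact mul_pos hl2 (by linarith [two_mul_lt_unitDropVolume hs])
  · exact isPreconnected_Ioi.intermediate_value_Ioi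
      (le_principal_iff.2 self_mem_nhdsWithin) (le_principal_iff.2 (Ioi_mem_atTop 0))
      hcont hzero htop
end

section
/- Fix l > 0 and define μ₀ : (0, ∞) → ℝ by μ₀(t) = λ(t)²·(π²/(4·ζ(t)²) − 1) + π²/4, where λ(t) = −2t/(l² + t²) and ζ(t) = arccos((l² − t²)/(l² + t²)). Then μ₀(t) tends to π²/4 + π²/(4l²) as t → 0⁺; in particular, the minimal stability eigenvalue of the cylindrical sessile drop is strictly positive in the small-volume limit. -/
open Real Filter

theorem arccos_sub_sq_div_add_sq {l t : ℝ} (hl : 0 < l) (ht : 0 ≤ t) :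
    Real.arccos ((l ^ 2 - t ^ 2) / (l ^ 2 + t ^ 2)) = 2 * Real.arctan (t / l) := by
  have hcos : Real.cos (2 * Real.arctan (t / l)) = (l ^ 2 - t ^ 2) / (l ^ 2 + t ^ 2) := by
    rw [Real.cos_two_mul, Real.cos_sq_arctan]
    field_simp
    ring
  have h0 : 0 ≤ Real.arctan (t / l) := Real.arctan_nonneg.2 (by positivity)
  have h1 := Real.arctan_lt_pi_div_two (t / l)
  rw [← hcos, Real.arccos_cos (by linarith) (by linarith)]

theorem tendsto_div_arctan_div {l : ℝ} (hl : 0 < l) :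
    Tendsto (fun t : ℝ => t / Real.arctan (t / l)) (nhdsWithin 0 (Set.Ioi 0)) (nhds l) := by
  have hd : HasDerivAt (fun t : ℝ => Real.arctan (t / l)) l⁻¹ 0 := by
    simpa using ((hasDerivAt_id (0 : ℝ)).div_const l).arctan
  have h := (hd.tendsto_slope_zero_right).inv₀ (inv_ne_zero hl.ne')
  simpa [div_eq_mul_inv, mul_comm] using h

theorem sessile_drop_eigenvalue_small_volume_limit (l : ℝ) (hl : 0 < l)
    (μ₀ : ℝ → ℝ)
    (hμ₀ : ∀ t : ℝ, μ₀ t =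
      (-2 * t / (l ^ 2 + t ^ 2)) ^ 2 *
          (π ^ 2 / (4 * Real.arccos ((l ^ 2 - t ^ 2) / (l ^ 2 + t ^ 2)) ^ 2) - 1) +
        π ^ 2 / 4) :
    Tendsto μ₀ (nhdsWithin 0 (Set.Ioi 0)) (nhds (π ^ 2 / 4 + π ^ 2 / (4 * l ^ 2))) ∧
    0 < π ^ 2 / 4 + π ^ 2 / (4 * l ^ 2) := by
  refine ⟨?_, by positivity⟩
  have ht : Tendsto (fun t : ℝ => t) (nhdsWithin 0 (Set.Ioi 0)) (nhds 0) :=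
    tendsto_id.mono_left nhdsWithin_le_nhds
  have hfactor : Tendsto (fun t : ℝ => (2 / (l ^ 2 + t ^ 2)) ^ 2)
      (nhdsWithin 0 (Set.Ioi 0)) (nhds ((2 / (l ^ 2 + 0 ^ 2)) ^ 2)) :=
    (tendsto_const_nhds.div (tendsto_const_nhds.add (ht.pow 2)) (by positivity)).pow 2
  have hlim := (hfactor.mul
    ((((tendsto_div_arctan_div hl).pow 2).const_mul (π ^ 2 / 16)).sub (ht.pow 2))).add_const
      (π ^ 2 / 4)
  have hval : (2 / (l ^ 2 + 0 ^ 2)) ^ 2 * (π ^ 2 / 16 * l ^ 2 - 0 ^ 2) + π ^ 2 / 4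
      = π ^ 2 / 4 + π ^ 2 / (4 * l ^ 2) := by
    field_simp
    ring
  rw [hval] at hlim
  refine hlim.congr' ?_
  filter_upwards [self_mem_nhdsWithin] with t htpos
  have htpos : 0 < t := htpos
  have harctan : 0 < Real.arctan (t / l) := Real.arctan_pos.2 (by positivity)
  rw [hμ₀, arccos_sub_sq_div_add_sq hl htpos.le]
  generalize Real.arctan (t / l) = a at harctan
  field_simp
  ring
end

section
/- For l = 1/5, define μ₀ : (0, ∞) → ℝ by μ₀(t) = λ(t)²·(π²/(4·ζ(t)²) − 1) + π²/4, where λ(t) = −2t/(l² + t²) and ζ(t) = arccos((l² − t²)/(l² + t²)). Then μ₀ is continuous on (0, ∞), and there exists a critical height t* > 0 with μ₀(t*) = 0; that is, for the strip half-width l = 1/5 the family of cylindrical sessile drops loses stability at a critical volume (the onset of the symmetry-breaking bifurcation). -/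
open Real

theorem sessile_drop_critical_height (l : ℝ) (hl : l = 1 / 5)
    (μ₀ : ℝ → ℝ)
    (hμ₀ : ∀ t : ℝ, μ₀ t =
      (-2 * t / (l ^ 2 + t ^ 2)) ^ 2 *
          (π ^ 2 / (4 * Real.arccos ((l ^ 2 - t ^ 2) / (l ^ 2 + t ^ 2)) ^ 2) - 1) +
        π ^ 2 / 4) :
    ContinuousOn μ₀ (Set.Ioi 0) ∧ ∃ t : ℝ, 0 < t ∧ μ₀ t = 0 := by
  have hden : ∀ t : ℝ, l ^ 2 + t ^ 2 ≠ 0 := fun t => by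
    have : 0 < l := by rw [hl]; norm_num
    positivity
  have hcont : ContinuousOn μ₀ (Set.Ioi 0) := by
    rw [funext hμ₀]
    have harg : Continuous fun t : ℝ => (l ^ 2 - t ^ 2) / (l ^ 2 + t ^ 2) :=
      Continuous.div (by fun_prop) (by fun_prop) hden
    have hcurv : Continuous fun t : ℝ => -2 * t / (l ^ 2 + t ^ 2) :=
      Continuous.div (by fun_prop) (by fun_prop) hden
    have hangle := continuous_arccos.comp harg
    refine ((hcurv.pow 2).continuousOn.mul ((continuousOn_const.div
      (continuous_const.mul (hangle.pow 2)).continuousOn ?_).sub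
        continuousOn_const)).add continuousOn_const
    intro t (ht : 0 < t)
    have hpos : 0 < arccos ((l ^ 2 - t ^ 2) / (l ^ 2 + t ^ 2)) := by
      rw [arccos_pos, div_lt_one (by positivity)]
      nlinarith
    exact mul_ne_zero four_ne_zero (pow_ne_zero 2 hpos.ne')
  refine ⟨hcont, ?_⟩
  have h3 : √3 ^ 2 = 3 := sq_sqrt (by norm_num)
  have h_one_le : (1 : ℝ) ≤ √3 := one_le_sqrt.mpr (by norm_num)
  have h_left : 0 ≤ μ₀ (1 / 5) := by
    have hangle : (π ^ 2 / (4 * (π / 2) ^ 2) - 1 : ℝ) = 0 := by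
      field_simp
      norm_num
    rw [hμ₀, hl, sub_self, zero_div, arccos_zero, hangle, mul_zero, zero_add]
    positivity
  have h_right : μ₀ (√3 / 5) ≤ 0 := by
    have harg : ((1 / 5 : ℝ) ^ 2 - (√3 / 5) ^ 2) / ((1 / 5) ^ 2 + (√3 / 5) ^ 2) = -(1 / 2) := by
      rw [div_pow √3, h3]
      norm_num
    have harccos : arccos (-(1 / 2)) = 2 * π / 3 := by
      rw [arccos_neg, ← cos_pi_div_three, arccos_cos (by positivity) (by linarith [pi_pos])]
      ring
    have hcurv : (-2 * (√3 / 5) / ((1 / 5) ^ 2 + (√3 / 5) ^ 2)) ^ 2 = 75 / 4 := by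
      rw [div_pow √3, h3, div_pow, mul_pow, div_pow, h3]
      norm_num
    have hangle : (π ^ 2 / (4 * (2 * π / 3) ^ 2) - 1 : ℝ) = -(7 / 16) := by
      field_simp
      norm_num
    rw [hμ₀, hl, harg, harccos, hcurv, hangle]
    nlinarith [pi_lt_four, pi_pos]
  obtain ⟨t, ht, h_zero⟩ := intermediate_value_Icc' (by linarith : (1 / 5 : ℝ) ≤ √3 / 5)
    (hcont.mono fun t ht => lt_of_lt_of_le (by norm_num) ht.1) ⟨h_right, h_left⟩
  exact ⟨t, lt_of_lt_of_le (by norm_num) ht.1, h_zero⟩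
end
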